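/- The elliptic Ruijsenaars–Schneider Lax matrix satisfies the Lax equation {H, L(z)} = [L(z), M(z)] (entrywise Poisson bracket with the Hamiltonian H = c·∑_{j=1}^N b_j, and matrix commutator), where M_{ij}(z) = −(1−δ_{ij})·φ(z, q_i−q_j)·b_j − δ_{ij}·( b_i·(E₁(z)+E₁(η)) + ∑_{k≠i} b_k·(E₁(q_i−q_k+η) − E₁(q_i−q_k)) ). -/

import Mathlib

open Complex Matrix Kronecker Finset Filter Topology

noncomputable section

/-- The lattice Λ = ℤ + τℤ. -/
def Lam (τ : ℂ) : Set ℂ := {z : ℂ | ∃ m n : ℤ, z = (m : ℂ) + (n : ℂ) * τ}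

/-- The first Jacobi theta function
ϑ(z) = −∑_{j∈ℤ} exp(πi(j+1/2)²τ + 2πi(j+1/2)(z+1/2)). -/
def theta (τ : ℂ) (z : ℂ) : ℂ :=
  -∑' j : ℤ, Complex.exp ((Real.pi : ℂ) * Complex.I * ((j : ℂ) + 1 / 2) ^ 2 * τ +
      2 * (Real.pi : ℂ) * Complex.I * ((j : ℂ) + 1 / 2) * (z + 1 / 2))

/-- The first Eisenstein function E₁(u) = ϑ′(u)/ϑ(u). -/
def E1 (τ : ℂ) (u : ℂ) : ℂ := deriv (theta τ) u / theta τ u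

/-- The Kronecker function φ(z,u) = ϑ′(0)·ϑ(z+u)/(ϑ(z)·ϑ(u)). -/
def phi (τ : ℂ) (z u : ℂ) : ℂ :=
  deriv (theta τ) 0 * theta τ (z + u) / (theta τ z * theta τ u)

/-- The second Eisenstein function E₂(u) = −E₁′(u). -/
def E2 (τ : ℂ) (u : ℂ) : ℂ := -deriv (E1 τ) u

/-- The Weierstrass ℘-function: ℘(u) = E₂(u) + (1/3)·ϑ‴(0)/ϑ′(0). -/
def wp (τ : ℂ) (u : ℂ) : ℂ :=
  E2 τ u + (1 / 3) * iteratedDeriv 3 (theta τ) 0 / deriv (theta τ) 0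

/-- Phase space ℂ^{2N} with coordinates (p, q). -/
abbrev Phase (N : ℕ) := (Fin N → ℂ) × (Fin N → ℂ)

/-- Canonical Poisson bracket
{f,g}(x) = ∑ᵢ (∂f/∂pᵢ·∂g/∂qᵢ − ∂f/∂qᵢ·∂g/∂pᵢ)(x). -/
def pbracket {N : ℕ} (f g : Phase N → ℂ) (x : Phase N) : ℂ :=
  ∑ i : Fin N,
    (deriv (fun t => f (Function.update x.1 i t, x.2)) (x.1 i) *
        deriv (fun t => g (x.1, Function.update x.2 i t)) (x.2 i) -
      deriv (fun t => f (x.1, Function.update x.2 i t)) (x.2 i) *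
        deriv (fun t => g (Function.update x.1 i t, x.2)) (x.1 i))

/-- b_j = e^{p_j/c}·∏_{k≠j} ϑ(q_j−q_k−η)/ϑ(q_j−q_k). -/
def bfun (τ η c : ℂ) {N : ℕ} (j : Fin N) (x : Phase N) : ℂ :=
  Complex.exp (x.1 j / c) *
    ∏ k ∈ Finset.univ.filter (fun k => k ≠ j),
      theta τ (x.2 j - x.2 k - η) / theta τ (x.2 j - x.2 k)

/-- The Ruijsenaars–Schneider Lax matrix L_{ij}(z) = φ(z, q_i−q_j+η)·b_j,
as a matrix-valued function on phase space. -/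
def Lax (τ η c : ℂ) {N : ℕ} (z : ℂ) (y : Phase N) : Matrix (Fin N) (Fin N) ℂ :=
  Matrix.of fun i j => phi τ z (y.2 i - y.2 j + η) * bfun τ η c j y

/-- The accompanying M-matrix of the Ruijsenaars–Schneider Lax pair, evaluated at
a point x of phase space:
M_{ij}(z) = −(1−δ_{ij})·φ(z,q_i−q_j)·b_j
  − δ_{ij}·(b_i·(E₁(z)+E₁(η)) + ∑_{k≠i} b_k·(E₁(q_i−q_k+η) − E₁(q_i−q_k))). -/
def Mmat (τ η c : ℂ) {N : ℕ} (z : ℂ) (x : Phase N) : Matrix (Fin N) (Fin N) ℂ :=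
  Matrix.of fun i j =>
    -(1 - (if i = j then (1 : ℂ) else 0)) * phi τ z (x.2 i - x.2 j) * bfun τ η c j x -
      (if i = j then (1 : ℂ) else 0) *
        (bfun τ η c i x * (E1 τ z + E1 τ η) +
          ∑ k ∈ Finset.univ.filter (fun k => k ≠ i),
            bfun τ η c k x * (E1 τ (x.2 i - x.2 k + η) - E1 τ (x.2 i - x.2 k)))


lemma theta_eq_jac (τ z : ℂ) : theta τ z =
    -(cexp (Real.pi * I * τ / 4 + Real.pi * I * (z + 1/2)) *
      jacobiTheta₂ (z + 1/2 + τ/2) τ) := by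
  unfold theta jacobiTheta₂
  rw [← tsum_mul_left]
  congr 1
  refine tsum_congr fun j => ?_
  rw [jacobiTheta₂_term, ← Complex.exp_add]
  congr 1
  ring

lemma theta_diff {τ : ℂ} (hτ : 0 < τ.im) : Differentiable ℂ (theta τ) := by
  have : theta τ = fun z => -(cexp (Real.pi * I * τ / 4 + Real.pi * I * (z + 1/2)) *
      jacobiTheta₂ (z + 1/2 + τ/2) τ) := funext (theta_eq_jac τ)
  rw [this]
  intro z
  refine DifferentiableAt.neg (DifferentiableAt.mul (by fun_prop) ?_)
  exact (differentiableAt_jacobiTheta₂_fst (z + 1/2 + τ/2) hτ).comp z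
    (f := fun z => z + 1/2 + τ/2) (by fun_prop)

lemma theta_add_one (τ z : ℂ) : theta τ (z + 1) = -theta τ z := by
  rw [theta_eq_jac, theta_eq_jac, show z + 1 + 1/2 + τ/2 = (z + 1/2 + τ/2) + 1 by ring,
    jacobiTheta₂_add_left,
    show (Real.pi * I * τ / 4 + Real.pi * I * (z + 1 + 1/2) : ℂ) =
      (Real.pi * I * τ / 4 + Real.pi * I * (z + 1/2)) + Real.pi * I by ring,
    Complex.exp_add _ (Real.pi * I), Complex.exp_pi_mul_I]
  ring

lemma theta_add_tau (τ z : ℂ) : theta τ (z + τ) =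
    -(cexp (-Real.pi * I * (τ + 2 * z)) * theta τ z) := by
  rw [theta_eq_jac, theta_eq_jac, show z + τ + 1/2 + τ/2 = (z + 1/2 + τ/2) + τ by ring,
    jacobiTheta₂_add_left']
  have : cexp (Real.pi * I * τ / 4 + Real.pi * I * (z + τ + 1/2)) *
      cexp (-Real.pi * I * (τ + 2 * (z + 1/2 + τ/2))) =
      -(cexp (-Real.pi * I * (τ + 2 * z)) *
        cexp (Real.pi * I * τ / 4 + Real.pi * I * (z + 1/2))) := by
    rw [← Complex.exp_add, ← Complex.exp_add,
      show (Real.pi * I * τ / 4 + Real.pi * I * (z + τ + 1/2) +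
        -Real.pi * I * (τ + 2 * (z + 1/2 + τ/2)) : ℂ) =
        (-Real.pi * I * (τ + 2 * z) + (Real.pi * I * τ / 4 + Real.pi * I * (z + 1/2))) -
          Real.pi * I by ring, Complex.exp_sub, Complex.exp_pi_mul_I]
    ring
  linear_combination (-jacobiTheta₂ (z + 1/2 + τ/2) τ) * this

lemma exists_jac_ne {τ : ℂ} (hτ : 0 < τ.im) : ∃ z, jacobiTheta₂ z τ ≠ 0 := by
  by_contra! h
  let f : ℤ → C(ℝ, ℂ) := fun n => ⟨fun t => jacobiTheta₂_term n t τ, by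
    unfold jacobiTheta₂_term; fun_prop⟩
  have hs : Summable fun n : ℤ => ‖(f n).restrict
      (⟨Set.uIcc (0:ℝ) 1, isCompact_uIcc⟩ : TopologicalSpace.Compacts ℝ)‖ := by
    have h0 := ((summable_jacobiTheta₂_term_iff 0 τ).mpr hτ).norm
    refine Summable.of_nonneg_of_le (fun _ => norm_nonneg _) (fun n => ?_) h0
    rw [ContinuousMap.norm_le _ (norm_nonneg _)]
    rintro ⟨t, ht⟩
    simp [f, norm_jacobiTheta₂_term]
  have H := intervalIntegral.hasSum_intervalIntegral_of_summable_norm hs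
  have e1 : (∫ t in (0:ℝ)..1, ∑' n, f n t) = 0 := by
    have : ∀ t : ℝ, ∑' n, f n t = 0 := fun t => h t
    simp [this]
  rw [e1] at H
  have e2 : (fun n => ∫ t in (0:ℝ)..1, f n t) = fun n : ℤ => if n = 0 then (1:ℂ) else 0 := by
    funext n
    split_ifs with hn
    · subst hn
      simp [f, jacobiTheta₂_term]
    · have : ∀ t : ℝ, f n t = cexp (Real.pi * I * n ^ 2 * τ) * cexp ((2 * Real.pi * I * n) * t) := by
        intro t
        simp only [f, ContinuousMap.coe_mk, jacobiTheta₂_term]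
        rw [← Complex.exp_add]; congr 1; ring
      simp_rw [this]
      rw [intervalIntegral.integral_const_mul, integral_exp_mul_complex]
      · have : cexp (2 * Real.pi * I * n * (1:ℝ)) = 1 := by
          rw [show (2 * Real.pi * I * n * (1:ℝ) : ℂ) = n * (2 * Real.pi * I) by push_cast; ring]
          exact Complex.exp_int_mul_two_pi_mul_I n
        rw [this]; simp
      · have : (n:ℂ) ≠ 0 := by exact_mod_cast hn
        have := Real.pi_ne_zero
        simp_all
  rw [e2] at H
  have := H.unique (hasSum_ite_eq (0:ℤ) (1:ℂ))
  simp at this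

lemma exists_theta_ne {τ : ℂ} (hτ : 0 < τ.im) : ∃ z, theta τ z ≠ 0 := by
  obtain ⟨z, hz⟩ := exists_jac_ne hτ
  refine ⟨z - 1/2 - τ/2, ?_⟩
  rw [theta_eq_jac, show z - 1/2 - τ/2 + 1/2 + τ/2 = z by ring]
  simp [hz, Complex.exp_ne_zero]

lemma theta_summand_summable {τ : ℂ} (hτ : 0 < τ.im) (z : ℂ) :
    Summable fun j : ℤ => cexp (Real.pi * I * ((j:ℂ) + 1/2)^2 * τ +
      2 * Real.pi * I * ((j : ℂ) + 1/2) * (z + 1/2)) := by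
  have h := ((summable_jacobiTheta₂_term_iff (z + 1/2 + τ/2) τ).mpr hτ).mul_left
    (cexp (Real.pi * I * τ / 4 + Real.pi * I * (z + 1/2)))
  refine h.congr fun j => ?_
  rw [jacobiTheta₂_term, ← Complex.exp_add]
  congr 1
  ring

def parityEquiv : (ℤ × ℤ) ⊕ (ℤ × ℤ) ≃ ℤ × ℤ where
  toFun := Sum.elim (fun p => (p.1 + p.2, p.1 - p.2 - 1)) (fun p => (p.1 + p.2, p.1 - p.2))
  invFun := fun p => if (p.1 + p.2) % 2 = 0 then Sum.inr ((p.1 + p.2)/2, (p.1 - p.2)/2)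
    else Sum.inl ((p.1 + p.2 + 1)/2, (p.1 - p.2 - 1)/2)
  left_inv := by
    rintro (⟨a, b⟩ | ⟨a, b⟩)
    · have : ¬ ((a + b + (a - b - 1)) % 2 = 0) := by omega
      simp only [Sum.elim_inl, this, if_false, Sum.inl.injEq, Prod.mk.injEq]
      omega
    · have : ((a + b + (a - b)) % 2 = 0) := by omega
      simp only [Sum.elim_inr, this, if_true, Sum.inr.injEq, Prod.mk.injEq]
      omega
  right_inv := by
    rintro ⟨a, b⟩
    by_cases h : (a + b) % 2 = 0
    · simp only [h, if_true, Sum.elim_inr, Prod.mk.injEq]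
      omega
    · simp only [h, if_false, Sum.elim_inl, Prod.mk.injEq]
      omega

lemma hasSum_congr_aux {ι : Type*} {f g : ι → ℂ} {a : ℂ} (h : HasSum f a) (e : ∀ i, g i = f i) :
    HasSum g a := (funext e : g = f) ▸ h

lemma theta_det {τ : ℂ} (hτ : 0 < τ.im) : ∃ A B : ℂ → ℂ, ∀ x y,
    theta τ (x + y) * theta τ (x - y) = A x * B y - B x * A y := by
  have hτ2 : 0 < (2 * τ).im := by simpa using hτ
  let e : ℤ → ℂ → ℂ := fun k x => cexp (Real.pi * I * τ * k^2 / 2 + 2 * Real.pi * I * k * x)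
  have hA : ∀ x, Summable fun a : ℤ => e (2 * a) x := fun x => by
    refine ((summable_jacobiTheta₂_term_iff (2 * x) (2 * τ)).mpr hτ2).congr fun j => ?_
    simp only [jacobiTheta₂_term, e]
    congr 1
    push_cast
    ring
  have hB : ∀ x, Summable fun a : ℤ => e (2 * a + 1) x := fun x => by
    refine (((summable_jacobiTheta₂_term_iff (2 * x + τ) (2 * τ)).mpr hτ2).mul_left
      (cexp (Real.pi * I * τ / 2 + 2 * Real.pi * I * x))).congr fun j => ?_
    simp only [jacobiTheta₂_term, e]
    rw [← Complex.exp_add]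
    congr 1
    push_cast
    ring
  refine ⟨fun x => ∑' a : ℤ, e (2 * a) x, fun x => ∑' a : ℤ, e (2 * a + 1) x, fun x y => ?_⟩
  have h1 := theta_summand_summable hτ (x + y)
  have h2 := theta_summand_summable hτ (x - y)

  unfold theta
  rw [neg_mul_neg, tsum_mul_tsum_of_summable_norm h1.norm h2.norm,
    tsum_mul_tsum_of_summable_norm (hA x).norm (hB y).norm,
    tsum_mul_tsum_of_summable_norm (hB x).norm (hA y).norm,
    ← parityEquiv.tsum_eq]
  have s1 := summable_mul_of_summable_norm (hA x).norm (hB y).norm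
  have s2 := summable_mul_of_summable_norm (hB x).norm (hA y).norm
  refine HasSum.tsum_eq ?_
  rw [sub_eq_add_neg (∑' (z : ℤ × ℤ), e (2 * z.1) x * e (2 * z.2 + 1) y)]
  refine HasSum.sum (M := ℂ) ?_ ?_
  · refine hasSum_congr_aux s1.hasSum fun p => ?_
    obtain ⟨a, b⟩ := p
    have aux : ∀ u v : ℂ, u = v + a * (2 * Real.pi * I) → cexp u = cexp v := by
      rintro u v rfl
      rw [Complex.exp_add, Complex.exp_int_mul_two_pi_mul_I a, mul_one]
    simp only [Function.comp, parityEquiv, Equiv.coe_fn_mk, Sum.elim_inl, e]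
    rw [← Complex.exp_add, ← Complex.exp_add]
    apply aux
    push_cast
    ring
  · rw [← tsum_neg]
    refine hasSum_congr_aux s2.neg.hasSum fun p => ?_
    obtain ⟨a, b⟩ := p
    have : cexp (a * (2 * Real.pi * I) + Real.pi * I) = -1 := by
      rw [Complex.exp_add, Complex.exp_int_mul_two_pi_mul_I a, Complex.exp_pi_mul_I, one_mul]
    simp only [Function.comp, parityEquiv, Equiv.coe_fn_mk, Sum.elim_inr, e]
    rw [← Complex.exp_add, ← Complex.exp_add, ← mul_neg_one (cexp (_ / 2 + _ + _)), ← this,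
      ← Complex.exp_add]
    congr 1
    push_cast
    ring

lemma theta_odd {τ : ℂ} (hτ : 0 < τ.im) (z : ℂ) : theta τ (-z) = -theta τ z := by
  obtain ⟨A, B, h⟩ := theta_det hτ
  obtain ⟨s, hs⟩ := exists_theta_ne hτ
  have h1 := h ((s + z)/2) ((s - z)/2)
  have h2 := h ((s - z)/2) ((s + z)/2)
  rw [show (s + z)/2 + (s - z)/2 = s by ring, show (s + z)/2 - (s - z)/2 = z by ring] at h1
  rw [show (s - z)/2 + (s + z)/2 = s by ring, show (s - z)/2 - (s + z)/2 = -z by ring] at h2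
  apply mul_left_cancel₀ hs
  linear_combination h1 + h2

lemma theta_zero {τ : ℂ} (hτ : 0 < τ.im) : theta τ 0 = 0 := by
  have := theta_odd hτ 0
  rw [neg_zero] at this
  exact self_eq_neg.mp this

/-- Weierstrass three-term identity -/
lemma theta_three {τ : ℂ} (hτ : 0 < τ.im) (x y u v : ℂ) :
    theta τ (x + y) * theta τ (x - y) * (theta τ (u + v) * theta τ (u - v)) =
    theta τ (x + u) * theta τ (x - u) * (theta τ (y + v) * theta τ (y - v)) -
    theta τ (x + v) * theta τ (x - v) * (theta τ (y + u) * theta τ (y - u)) := by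
  obtain ⟨A, B, h⟩ := theta_det hτ
  simp only [h]
  ring

lemma theta_hasDeriv {τ : ℂ} (hτ : 0 < τ.im) (z : ℂ) :
    HasDerivAt (theta τ) (deriv (theta τ) z) z := (theta_diff hτ z).hasDerivAt

lemma theta_comp {τ : ℂ} (hτ : 0 < τ.im) {f : ℂ → ℂ} {f' x : ℂ} (hf : HasDerivAt f f' x) :
    HasDerivAt (fun t => theta τ (f t)) (deriv (theta τ) (f x) * f') x :=
  HasDerivAt.comp (h₂ := theta τ) (h := f) x (theta_hasDeriv hτ (f x)) hf

lemma wronsk {f g : ℂ → ℂ} (hf : Differentiable ℂ f) (hg : Differentiable ℂ g) (a t : ℂ)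
    (ht : g t ≠ 0) (ha : ∀ s, deriv f s * g s - f s * deriv g s = a * (f s * g s)) :
    ∃ K, ∀ s, f s = K * cexp (a * s) * g s := by
  refine ⟨f t / (cexp (a * t) * g t), ?_⟩
  set K := f t / (cexp (a * t) * g t) with hKdef
  have hd2 : Differentiable ℂ fun s => K * cexp (a * s) * g s := by fun_prop
  have han2 : AnalyticOnNhd ℂ (fun s => K * cexp (a * s) * g s) Set.univ :=
    fun z _ => hd2.analyticAt z
  have hanw : AnalyticOnNhd ℂ f Set.univ := fun z _ => hf.analyticAt z
  obtain ⟨r, hr, hball⟩ := Metric.eventually_nhds_iff_ball.mp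
    (hg.continuous.continuousAt.eventually_ne ht)
  have d3 : ∀ s ∈ Metric.ball t r, HasDerivAt (fun s => f s / (cexp (a * s) * g s)) 0 s := by
    intro s hs
    have d2 : HasDerivAt (fun s => cexp (a * s)) (cexp (a * s) * a) s := by
      simpa using ((hasDerivAt_id s).const_mul a).cexp
    have d3 := (hf s).hasDerivAt.fun_div (d2.fun_mul (hg s).hasDerivAt)
      (mul_ne_zero (Complex.exp_ne_zero _) (hball s hs))
    refine d3.congr_deriv ?_
    rw [div_eq_zero_iff]
    left
    linear_combination cexp (a * s) * ha s
  have key : Set.EqOn (fun s => f s / (cexp (a * s) * g s)) (fun _ => K)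
      (Metric.ball t r) := by
    intro s hs
    refine (Metric.isOpen_ball).is_const_of_deriv_eq_zero (convex_ball t r).isPreconnected
      (f := fun s => f s / (cexp (a * s) * g s)) ?_ ?_ hs
      (Metric.mem_ball_self hr)
    · intro s hs
      exact (d3 s hs).differentiableAt.differentiableWithinAt
    · intro s hs
      exact (d3 s hs).deriv
  have := hanw.eq_of_eventuallyEq han2 (z₀ := t) (by
    filter_upwards [Metric.ball_mem_nhds t hr] with s hs
    have h1 := key hs
    have h2 := hball s hs
    have h3 := Complex.exp_ne_zero (a * s)
    simp only at h1
    rw [← h1]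
    field_simp)
  exact fun s => congrFun this s

lemma theta_shift {τ : ℂ} (hτ : 0 < τ.im) {w : ℂ} (hw : theta τ w = 0) (s t h : ℂ) :
    theta τ (s + h + w) * theta τ (t - h + w) * (theta τ s * theta τ t) =
    theta τ (s + w) * theta τ (t + w) * (theta τ (s + h) * theta τ (t - h)) := by
  -- x = y + w
  have := theta_three hτ ((s + t)/2 + w) ((s+t)/2) ((s - t)/2 + h) ((s - t)/2)
  rw [show (s + t)/2 + w - (s+t)/2 = w by ring, hw,
    show (s + t)/2 + w + ((s - t)/2 + h) = s + h + w by ring,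
    show (s + t)/2 + w - ((s - t)/2 + h) = t - h + w by ring,
    show (s + t)/2 + (s - t)/2 = s by ring,
    show (s + t)/2 - (s - t)/2 = t by ring,
    show (s + t)/2 + w + (s - t)/2 = s + w by ring,
    show (s + t)/2 + w - (s - t)/2 = t + w by ring,
    show (s + t)/2 + ((s - t)/2 + h) = s + h by ring,
    show (s + t)/2 - ((s - t)/2 + h) = t - h by ring] at this
  linear_combination -this

lemma theta_ne {τ : ℂ} (hτ : 0 < τ.im) {w : ℂ} (hw : w ∉ Lam τ) : theta τ w ≠ 0 := by
  intro h0
  apply hw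
  have hd := theta_diff hτ
  have han : AnalyticOnNhd ℂ (theta τ) Set.univ := fun z _ => hd.analyticAt z
  have hdw : Differentiable ℂ fun s => theta τ (s + w) := by fun_prop
  have hanw : AnalyticOnNhd ℂ (fun s => theta τ (s + w)) Set.univ := fun z _ => hdw.analyticAt z
  obtain ⟨z0, hz0⟩ := exists_theta_ne hτ
  obtain ⟨t, ht, htw⟩ : ∃ t, theta τ t ≠ 0 ∧ theta τ (t + w) ≠ 0 := by
    by_contra! hcon
    have := AnalyticOnNhd.eq_zero_or_eq_zero_of_mul_eq_zero han hanw
      (fun z _ => by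
        by_cases hz : theta τ z = 0
        · simp [hz]
        · simp [hcon z hz]) isPreconnected_univ
    rcases this with h | h
    · exact hz0 (h z0 trivial)
    · exact hz0 (by simpa using h (z0 - w) trivial)
  obtain ⟨a, ha⟩ : ∃ a, ∀ s, deriv (theta τ) (s + w) * theta τ s -
      theta τ (s + w) * deriv (theta τ) s = a * (theta τ (s + w) * theta τ s) := by
    refine ⟨deriv (theta τ) (t + w) / theta τ (t + w) - deriv (theta τ) t / theta τ t, fun s => ?_⟩
    have e1 : HasDerivAt (fun h => theta τ (s + h + w)) (deriv (theta τ) (s + w)) 0 := by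
      simpa using theta_comp hτ (((hasDerivAt_id (0:ℂ)).const_add s).add_const w)
    have e2 : HasDerivAt (fun h => theta τ (t - h + w)) (-deriv (theta τ) (t + w)) 0 := by
      simpa using theta_comp hτ (((hasDerivAt_id (0:ℂ)).const_sub t).add_const w)
    have e3 : HasDerivAt (fun h => theta τ (s + h)) (deriv (theta τ) s) 0 := by
      simpa using theta_comp hτ ((hasDerivAt_id (0:ℂ)).const_add s)
    have e4 : HasDerivAt (fun h => theta τ (t - h)) (-deriv (theta τ) t) 0 := by
      simpa using theta_comp hτ ((hasDerivAt_id (0:ℂ)).const_sub t)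
    have E1 := (e1.mul e2).mul_const (theta τ s * theta τ t)
    have E2 := (e3.mul e4).const_mul (theta τ (s + w) * theta τ (t + w))
    have hfun := funext (theta_shift hτ h0 s t)
    have := E1.unique (hfun ▸ E2)
    simp only [add_zero, sub_zero] at this
    field_simp
    linear_combination this
  obtain ⟨K, hK⟩ : ∃ K, ∀ s, theta τ (s + w) = K * cexp (a * s) * theta τ s := by
    refine wronsk hdw hd a t ht fun s => ?_
    have d1 : HasDerivAt (fun s => theta τ (s + w)) (deriv (theta τ) (s + w)) s := by
      simpa using theta_comp hτ ((hasDerivAt_id s).add_const w)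
    rw [d1.deriv]
    exact ha s
  have hKt := hK t
  have h1 := hK (t + 1)
  have h2 := hK (t + τ)
  have hK0 : K ≠ 0 := by
    rintro rfl
    simp at hKt
    exact htw hKt
  have hea := Complex.exp_ne_zero (a * t)
  rw [show t + 1 + w = (t + w) + 1 by ring, theta_add_one, theta_add_one, hKt, mul_add,
    Complex.exp_add, mul_one] at h1
  rw [show t + τ + w = (t + w) + τ by ring, theta_add_tau, theta_add_tau, hKt, mul_add a,
    Complex.exp_add (a * t),
    show (-Real.pi * I * (τ + 2 * (t + w)) : ℂ) = -Real.pi * I * (τ + 2 * t) + (-(2 * Real.pi * I * w))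
      by ring, Complex.exp_add (-Real.pi * I * (τ + 2 * t))] at h2
  have hX : K * cexp (a * t) * theta τ t ≠ 0 := mul_ne_zero (mul_ne_zero hK0 hea) ht
  have h1' : cexp a = 1 := by
    apply mul_left_cancel₀ hX
    linear_combination h1
  have h2' : cexp (-(2 * Real.pi * I * w)) = cexp (a * τ) := by
    apply mul_left_cancel₀ (mul_ne_zero hX (Complex.exp_ne_zero (-Real.pi * I * (τ + 2 * t))))
    linear_combination -h2
  obtain ⟨n, hn⟩ := Complex.exp_eq_one_iff.mp h1'
  obtain ⟨m, hm⟩ := Complex.exp_eq_exp_iff_exists_int.mp h2'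
  refine ⟨-m, -n, ?_⟩
  have hpi : (2 * Real.pi * I : ℂ) ≠ 0 := Complex.two_pi_I_ne_zero
  apply mul_left_cancel₀ hpi
  push_cast
  rw [hn] at hm
  linear_combination -hm

lemma deriv_theta_neg {τ : ℂ} (hτ : 0 < τ.im) (z : ℂ) :
    deriv (theta τ) (-z) = deriv (theta τ) z := by
  have h1 : HasDerivAt (fun t => theta τ (-t)) (deriv (theta τ) (-z) * (-1)) z :=
    theta_comp hτ (hasDerivAt_neg z)
  have h2 : HasDerivAt (fun t => theta τ (-t)) (-deriv (theta τ) z) z := by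
    rw [show (fun t => theta τ (-t)) = fun t => -theta τ t from funext (theta_odd hτ)]
    exact (theta_hasDeriv hτ z).fun_neg
  linear_combination -h1.unique h2

lemma E1_neg {τ : ℂ} (hτ : 0 < τ.im) (z : ℂ) : E1 τ (-z) = -E1 τ z := by
  unfold E1
  rw [deriv_theta_neg hτ, theta_odd hτ, div_neg]

lemma theta_four {τ : ℂ} (hτ : 0 < τ.im) (z u v : ℂ) :
    deriv (theta τ) 0 * theta τ (u + v) * (theta τ (z + u) * theta τ (z + v)) =
    (deriv (theta τ) u * theta τ v + theta τ u * deriv (theta τ) v) *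
      (theta τ z * theta τ (z + u + v)) +
    (deriv (theta τ) z * theta τ (z + u + v) - theta τ z * deriv (theta τ) (z + u + v)) *
      (theta τ u * theta τ v) := by
  have hfun := funext (fun x => theta_three hτ x ((u+v)/2) ((u - v)/2) (-z - (u+v)/2))
  have p (w : ℂ) : HasDerivAt (fun x => theta τ (x + w)) (deriv (theta τ) ((u+v)/2 + w)) ((u+v)/2) := by
    simpa using theta_comp hτ ((hasDerivAt_id ((u+v)/2)).add_const w)
  have m (w : ℂ) : HasDerivAt (fun x => theta τ (x - w)) (deriv (theta τ) ((u+v)/2 - w)) ((u+v)/2) := by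
    simpa using theta_comp hτ ((hasDerivAt_id ((u+v)/2)).sub_const w)
  have D1 := ((p ((u+v)/2)).fun_mul (m ((u+v)/2))).mul_const
    (theta τ ((u-v)/2 + (-z - (u+v)/2)) * theta τ ((u-v)/2 - (-z - (u+v)/2)))
  have D2 := (((p ((u-v)/2)).fun_mul (m ((u-v)/2))).mul_const
    (theta τ ((u+v)/2 + (-z - (u+v)/2)) * theta τ ((u+v)/2 - (-z - (u+v)/2)))).fun_sub
    (((p (-z - (u+v)/2)).fun_mul (m (-z - (u+v)/2))).mul_const
    (theta τ ((u+v)/2 + (u-v)/2) * theta τ ((u+v)/2 - (u-v)/2)))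
  rw [hfun] at D1
  have := D1.unique D2
  rw [show (u+v)/2 - (u+v)/2 = 0 by ring, show (u+v)/2 + (u+v)/2 = u + v by ring,
    show (u-v)/2 + (-z - (u+v)/2) = -(z + v) by ring,
    show (u-v)/2 - (-z - (u+v)/2) = z + u by ring,
    show (u+v)/2 + (u-v)/2 = u by ring,
    show (u+v)/2 - (u-v)/2 = v by ring,
    show (u+v)/2 + (-z - (u+v)/2) = -z by ring,
    show (u+v)/2 - (-z - (u+v)/2) = z + u + v by ring,
    theta_zero hτ, theta_odd hτ, theta_odd hτ, deriv_theta_neg hτ] at this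
  linear_combination -this

lemma phi_mul {τ : ℂ} (hτ : 0 < τ.im) {z u v : ℂ} (hz : theta τ z ≠ 0) (hu : theta τ u ≠ 0)
    (hv : theta τ v ≠ 0) (huv : theta τ (u + v) ≠ 0) (hs : theta τ (z + (u + v)) ≠ 0) :
    phi τ z u * phi τ z v =
      phi τ z (u + v) * (E1 τ z + E1 τ u + E1 τ v - E1 τ (z + (u + v))) := by
  have h := theta_four hτ z u v
  rw [add_assoc z u v] at h
  unfold phi E1
  field_simp
  linear_combination deriv (theta τ) 0 * h

lemma phi_hasDeriv {τ : ℂ} (hτ : 0 < τ.im) {z u : ℂ} (hu : theta τ u ≠ 0)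
    (hs : theta τ (z + u) ≠ 0) {f : ℂ → ℂ} {f' x : ℂ} (hf : HasDerivAt f f' x) (hfx : f x = u) :
    HasDerivAt (fun t => phi τ z (f t)) (phi τ z u * (E1 τ (z + u) - E1 τ u) * f') x := by
  subst hfx
  have h1 := theta_comp hτ hf
  have h2 := (theta_comp hτ (hf.const_add z)).const_mul (deriv (theta τ) 0)
  by_cases hz : theta τ z = 0
  · simp only [phi, hz, zero_mul, div_zero]
    exact hasDerivAt_const _ _
  have h3 := h2.fun_div (h1.const_mul (theta τ z)) (mul_ne_zero hz hu)
  refine h3.congr_deriv ?_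
  unfold phi E1
  field_simp

lemma quot_hasDeriv {τ : ℂ} (hτ : 0 < τ.im) {f g : ℂ → ℂ} {f' g' x : ℂ}
    (hf : HasDerivAt f f' x) (hg : HasDerivAt g g' x) (h1 : theta τ (f x) ≠ 0)
    (h2 : theta τ (g x) ≠ 0) :
    HasDerivAt (fun t => theta τ (f t) / theta τ (g t))
      (theta τ (f x) / theta τ (g x) * (f' * E1 τ (f x) - g' * E1 τ (g x))) x := by
  refine ((theta_comp hτ hf).fun_div (theta_comp hτ hg) h2).congr_deriv ?_
  unfold E1
  field_simp

lemma prod_hasDeriv {ι : Type*} [DecidableEq ι] (s : Finset ι) (f : ι → ℂ → ℂ) (d : ι → ℂ) (x : ℂ)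
    (h : ∀ i ∈ s, HasDerivAt (f i) (f i x * d i) x) :
    HasDerivAt (fun t => ∏ i ∈ s, f i t) ((∏ i ∈ s, f i x) * ∑ i ∈ s, d i) x := by
  induction s using Finset.induction_on with
  | empty => simpa using hasDerivAt_const x (1:ℂ)
  | insert a s ha ih =>
    simp only [Finset.prod_insert ha, Finset.sum_insert ha]
    refine ((h a (Finset.mem_insert_self a s)).fun_mul
      (ih fun i hi => h i (Finset.mem_insert_of_mem hi))).congr_deriv ?_
    ring

/-- logarithmic derivative of `b_m` in the direction `q_k` -/
def DD (τ η : ℂ) {N : ℕ} (q : Fin N → ℂ) (k m : Fin N) : ℂ :=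
  ∑ l ∈ Finset.univ.filter (fun l => l ≠ m),
    ((if m = k then (1:ℂ) else 0) - (if l = k then (1:ℂ) else 0)) *
      (E1 τ (q m - q l - η) - E1 τ (q m - q l))

lemma DD_ne (τ η : ℂ) {N : ℕ} (q : Fin N → ℂ) {k m : Fin N} (h : m ≠ k) :
    DD τ η q k m = E1 τ (q m - q k) - E1 τ (q m - q k - η) := by
  unfold DD
  rw [Finset.sum_eq_single k]
  · simp [h]
  · intro l _ hl
    simp [h, hl]
  · intro hk
    exact absurd (Finset.mem_filter.mpr ⟨Finset.mem_univ k, h.symm⟩) hk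

lemma update_hasDeriv {N : ℕ} (q : Fin N → ℂ) (k m : Fin N) :
    HasDerivAt (fun t => Function.update q k t m) (if m = k then (1:ℂ) else 0) (q k) := by
  split_ifs with h
  · subst h
    simpa using hasDerivAt_id' (q m)
  · simpa [Function.update_of_ne h] using hasDerivAt_const (q k) (q m)

lemma bfun_q {τ η c : ℂ} (hτ : 0 < τ.im) {N : ℕ} (x : Phase N)
    (hq : ∀ i j : Fin N, i ≠ j → x.2 i - x.2 j ∉ Lam τ)
    (hqm : ∀ i j : Fin N, i ≠ j → x.2 i - x.2 j - η ∉ Lam τ) (k m : Fin N) :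
    HasDerivAt (fun t => bfun τ η c m (x.1, Function.update x.2 k t))
      (bfun τ η c m x * DD τ η x.2 k m) (x.2 k) := by
  unfold bfun
  have hP := prod_hasDeriv (Finset.univ.filter (fun l => l ≠ m))
    (fun l t => theta τ (Function.update x.2 k t m - Function.update x.2 k t l - η) /
      theta τ (Function.update x.2 k t m - Function.update x.2 k t l))
    (fun l => ((if m = k then (1:ℂ) else 0) - (if l = k then (1:ℂ) else 0)) *
      (E1 τ (x.2 m - x.2 l - η) - E1 τ (x.2 m - x.2 l))) (x.2 k) (by
    intro l hl
    have hl' : m ≠ l := (Finset.mem_filter.mp hl).2.symm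
    have h2 := (update_hasDeriv x.2 k m).fun_sub (update_hasDeriv x.2 k l)
    have h1 := h2.sub_const η
    have := quot_hasDeriv hτ h1 h2
      (by simpa using theta_ne hτ (hqm m l hl')) (by simpa using theta_ne hτ (hq m l hl'))
    refine this.congr_deriv ?_
    simp only [Function.update_eq_self]
    ring)
  refine (hP.const_mul (cexp (x.1 m / c))).congr_deriv ?_
  simp only [Function.update_eq_self, DD]
  ring

lemma bfun_p (τ η c : ℂ) {N : ℕ} (x : Phase N) (k m : Fin N) :
    HasDerivAt (fun t => bfun τ η c m (Function.update x.1 k t, x.2))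
      (bfun τ η c m x * ((if m = k then (1:ℂ) else 0) / c)) (x.1 k) := by
  unfold bfun
  dsimp only
  refine ((((update_hasDeriv x.1 k m).div_const c).cexp).mul_const _).congr_deriv ?_
  simp only [Function.update_eq_self]
  ring

/-- the Ruijsenaars–Schneider Lax matrix satisfies the Lax equation
{H, L(z)} = [L(z), M(z)] (entrywise Poisson bracket with H = c·∑_j b_j). -/
theorem rs_lax_equation {N : ℕ} (τ η c : ℂ) (hτ : 0 < τ.im) (hc : c ≠ 0)
    (z : ℂ) (x : Phase N)
    (hz : z ∉ Lam τ) (hη : η ∉ Lam τ)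
    (hq : ∀ i j : Fin N, i ≠ j → x.2 i - x.2 j ∉ Lam τ)
    (hqp : ∀ i j : Fin N, i ≠ j → x.2 i - x.2 j + η ∉ Lam τ)
    (hqm : ∀ i j : Fin N, i ≠ j → x.2 i - x.2 j - η ∉ Lam τ)
    (hzq : ∀ i j : Fin N, z + (x.2 i - x.2 j) + η ∉ Lam τ) :
    (Matrix.of fun i j =>
        pbracket (fun y => c * ∑ m : Fin N, bfun τ η c m y)
          (fun y => Lax τ η c z y i j) x) =
      Lax τ η c z x * Mmat τ η c z x - Mmat τ η c z x * Lax τ η c z x := by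
  have tz := theta_ne hτ hz
  have tη := theta_ne hτ hη
  have tq : ∀ i j : Fin N, i ≠ j → theta τ (x.2 i - x.2 j) ≠ 0 :=
    fun i j h => theta_ne hτ (hq i j h)
  have tqp : ∀ i j : Fin N, theta τ (x.2 i - x.2 j + η) ≠ 0 := fun i j => by
    by_cases h : i = j
    · subst h; simpa using tη
    · exact theta_ne hτ (hqp i j h)
  have tzq : ∀ i j : Fin N, theta τ (z + (x.2 i - x.2 j + η)) ≠ 0 := fun i j => by
    rw [← add_assoc]; exact theta_ne hτ (hzq i j)
  ext i j
  simp only [Matrix.of_apply, Matrix.sub_apply, Matrix.mul_apply]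
  set Φ := phi τ z (x.2 i - x.2 j + η) with hΦ
  set W := E1 τ (z + (x.2 i - x.2 j + η)) with hW
  set V := E1 τ (x.2 i - x.2 j + η) with hV
  set b : Fin N → ℂ := fun k => bfun τ η c k x with hb
  -- derivatives
  have hHp : ∀ k, deriv (fun t => c * ∑ m : Fin N,
      bfun τ η c m (Function.update x.1 k t, x.2)) (x.1 k) = b k := fun k => by
    have := (HasDerivAt.fun_sum (u := Finset.univ)
      fun m _ => bfun_p τ η c x k m).const_mul c
    rw [this.deriv]
    rw [Finset.sum_eq_single k]
    · simp only [if_true, hb]; field_simp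
    · intro m _ hm; simp [hm]
    · simp
  have hHq : ∀ k, deriv (fun t => c * ∑ m : Fin N,
      bfun τ η c m (x.1, Function.update x.2 k t)) (x.2 k) =
      c * ∑ m, b m * DD τ η x.2 k m := fun k =>
    ((HasDerivAt.fun_sum (u := Finset.univ)
      fun m _ => bfun_q (c := c) hτ x hq hqm k m).const_mul c).deriv
  have hLp : ∀ k, deriv (fun t => Lax τ η c z (Function.update x.1 k t, x.2) i j) (x.1 k) =
      Φ * (b j * ((if j = k then (1:ℂ) else 0) / c)) := fun k =>
    ((bfun_p τ η c x k j).const_mul Φ).deriv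
  have hLq : ∀ k, deriv (fun t => Lax τ η c z (x.1, Function.update x.2 k t) i j) (x.2 k) =
      Φ * (W - V) * ((if i = k then (1:ℂ) else 0) - (if j = k then (1:ℂ) else 0)) * b j +
        Φ * (b j * DD τ η x.2 k j) := fun k => by
    have h1 := ((update_hasDeriv x.2 k i).fun_sub (update_hasDeriv x.2 k j)).add_const η
    have h2 := phi_hasDeriv hτ (tqp i j) (tzq i j) h1 (by simp)
    have h3 := (h2.fun_mul (bfun_q (c := c) hτ x hq hqm k j)).deriv
    refine Eq.trans h3 ?_
    simp only [Function.update_eq_self]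
    rfl
  have hL : pbracket (fun y => c * ∑ m : Fin N, bfun τ η c m y)
      (fun y => Lax τ η c z y i j) x = ∑ k, b j * b k * (Φ * (W - V) *
        ((if i = k then (1:ℂ) else 0) - (if j = k then (1:ℂ) else 0)) +
        Φ * (DD τ η x.2 k j - DD τ η x.2 j k)) := by
    unfold pbracket
    simp only [hHp, hHq, hLp, hLq]
    rw [Finset.sum_sub_distrib]
    have : ∑ k, (c * ∑ m, b m * DD τ η x.2 k m) *
        (Φ * (b j * ((if j = k then (1:ℂ) else 0) / c))) =
        ∑ m, b m * DD τ η x.2 j m * (Φ * b j) := by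
      rw [Finset.sum_eq_single j]
      · rw [← Finset.sum_mul]; simp only [if_true]; field_simp
      · intro k _ hk; simp [hk.symm]
      · simp
    rw [this, ← Finset.sum_sub_distrib]
    refine Finset.sum_congr rfl fun k _ => ?_
    ring
  rw [hL]
  let d : Fin N → Fin N → ℂ := fun m k => if k = m then E1 τ z + E1 τ η else
    E1 τ (x.2 m - x.2 k + η) - E1 τ (x.2 m - x.2 k)
  have hdiag : ∀ m, b m * (E1 τ z + E1 τ η) + ∑ k ∈ Finset.univ.filter (fun k => k ≠ m),
      b k * (E1 τ (x.2 m - x.2 k + η) - E1 τ (x.2 m - x.2 k)) = ∑ k, b k * d m k := fun m => by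
    rw [← Finset.add_sum_erase _ _ (Finset.mem_univ m), Finset.filter_ne' Finset.univ m]
    congr 1
    · simp [d]
    · refine Finset.sum_congr rfl fun k hk => ?_
      simp [d, Finset.ne_of_mem_erase hk]
  have hLe : ∀ m k, Lax τ η c z x m k = phi τ z (x.2 m - x.2 k + η) * b k := fun m k => rfl
  have hMe : ∀ m k, Mmat τ η c z x m k =
      -(1 - (if m = k then (1 : ℂ) else 0)) * phi τ z (x.2 m - x.2 k) * b k -
      (if m = k then (1 : ℂ) else 0) * ∑ l, b l * d m l := fun m k => by
    rw [← hdiag]; rfl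
  have hR1 : ∑ k, Lax τ η c z x i k * Mmat τ η c z x k j =
      ∑ k, (-(1 - (if k = j then (1 : ℂ) else 0)) * phi τ z (x.2 i - x.2 k + η) *
        phi τ z (x.2 k - x.2 j) * b k * b j) - Φ * b j * ∑ l, b l * d j l := by
    simp only [hLe, hMe, mul_sub, Finset.sum_sub_distrib]
    congr 1
    · refine Finset.sum_congr rfl fun k _ => ?_
      ring
    · rw [Finset.sum_eq_single j]
      · simp only [if_true, one_mul, hΦ]
      · intro k _ hk; simp [hk]
      · simp
  have hR2 : ∑ k, Mmat τ η c z x i k * Lax τ η c z x k j =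
      ∑ k, (-(1 - (if i = k then (1 : ℂ) else 0)) * phi τ z (x.2 i - x.2 k) *
        phi τ z (x.2 k - x.2 j + η) * b k * b j) - Φ * b j * ∑ l, b l * d i l := by
    simp only [hLe, hMe, sub_mul, Finset.sum_sub_distrib]
    congr 1
    · refine Finset.sum_congr rfl fun k _ => ?_
      ring
    · rw [Finset.sum_eq_single i]
      · simp only [if_true, one_mul, hΦ]; ring
      · intro k _ hk; simp [hk.symm]
      · simp
  rw [hR1, hR2, Finset.mul_sum, Finset.mul_sum, ← Finset.sum_sub_distrib, ← Finset.sum_sub_distrib,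
    ← Finset.sum_sub_distrib]
  refine Finset.sum_congr rfl fun k _ => ?_
  -- product formulas
  have P1 : k ≠ j → phi τ z (x.2 i - x.2 k + η) * phi τ z (x.2 k - x.2 j) =
      Φ * (E1 τ z + E1 τ (x.2 i - x.2 k + η) + E1 τ (x.2 k - x.2 j) - W) := fun h => by
    have e : x.2 i - x.2 k + η + (x.2 k - x.2 j) = x.2 i - x.2 j + η := by ring
    have := phi_mul hτ tz (tqp i k) (tq k j h) (by rw [e]; exact tqp i j)
      (by rw [e]; exact tzq i j)
    rw [e] at this
    exact this
  have P2 : i ≠ k → phi τ z (x.2 i - x.2 k) * phi τ z (x.2 k - x.2 j + η) =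
      Φ * (E1 τ z + E1 τ (x.2 i - x.2 k) + E1 τ (x.2 k - x.2 j + η) - W) := fun h => by
    have e : x.2 i - x.2 k + (x.2 k - x.2 j + η) = x.2 i - x.2 j + η := by ring
    have := phi_mul hτ tz (tq i k h) (tqp k j) (by rw [e]; exact tqp i j)
      (by rw [e]; exact tzq i j)
    rw [e] at this
    exact this
  by_cases hkj : k = j
  · by_cases hik : i = k
    · have hij : i = j := hik.trans hkj
      simp only [hkj, hij, if_true, d]
      ring
    · have P := P2 hik
      have hij : ¬ i = j := fun h => hik (h.trans hkj.symm)
      have hji : ¬ j = i := fun h => hij h.symm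
      subst hkj
      simp only [hik, hji, if_true, if_false, d]
      rw [show x.2 k - x.2 k + η = η by ring] at P ⊢
      linear_combination -(b k * b k) * P
  · have P := P1 hkj
    have hjk : ¬ j = k := fun h => hkj h.symm
    have o1 : E1 τ (x.2 j - x.2 k) = -E1 τ (x.2 k - x.2 j) := by
      rw [← E1_neg hτ]; congr 1; ring
    have o2 : E1 τ (x.2 j - x.2 k - η) = -E1 τ (x.2 k - x.2 j + η) := by
      rw [← E1_neg hτ]; congr 1; ring
    have o3 : E1 τ (x.2 k - x.2 j - η) = -E1 τ (x.2 j - x.2 k + η) := by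
      rw [← E1_neg hτ]; congr 1; ring
    rw [DD_ne τ η x.2 hjk, DD_ne τ η x.2 hkj]
    by_cases hik : i = k
    · subst hik
      simp only [hkj, hjk, if_true, if_false, d]
      rw [show x.2 i - x.2 i + η = η by ring] at P ⊢
      rw [o1, o2, o3]
      linear_combination (b i * b j) * P
    · have Q := P2 hik
      have hki : ¬ k = i := fun h => hik h.symm
      simp only [hkj, hjk, hik, hki, if_false, d]
      rw [o1, o2, o3]
      linear_combination (b k * b j) * P - (b k * b j) * Q

end
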